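/- arXiv:2210.01366 — 2 statements merged into one kernel-verified Lean document; each statement's English description precedes it below -/
import Mathlib

section
/- Let S ⊆ E be a finite set, let A = convexHull ℝ S, and suppose the affine span of A has dimension 2 (A is a planar convex polygon). Assume that for all vertices p, q, r, s of A such that p and q are adjacent, r is adjacent to p with r ≠ q, and s is adjacent to q with s ≠ p, one has ∠ r p q + ∠ s q p < π (the interior angles at the two endpoints of any edge sum to less than π). Then A has exactly 3 vertices, i.e. A is a triangle. -/
/-- Oriented area of the triangle `p q x` in the coordinates `X, Y`. -/
def areaW {E : Type*} (X Y : E → ℝ) (p q x : E) : ℝ :=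
  (X q - X p) * (Y x - Y p) - (Y q - Y p) * (X x - X p)

/-- No point of `V` is in the convex hull of three others. -/
def ConvPos {E : Type*} (V : Finset E) (X Y : E → ℝ) : Prop :=
  ∀ p ∈ V, ∀ x ∈ V, ∀ y ∈ V, ∀ z ∈ V, x ≠ p → y ≠ p → z ≠ p → ∀ a b c : ℝ,
    0 ≤ a → 0 ≤ b → 0 ≤ c → 0 < a + b + c →
    a * (X x - X p) + b * (X y - X p) + c * (X z - X p) = 0 →
    a * (Y x - Y p) + b * (Y y - Y p) + c * (Y z - Y p) = 0 → False

/-- `q` follows `p` in counterclockwise order. -/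
def NextV {E : Type*} (V : Finset E) (X Y : E → ℝ) (p q : E) : Prop :=
  ∀ x ∈ V, x ≠ p → x ≠ q → 0 < areaW X Y p q x

theorem exists_min_aux {E : Type*} (V : Finset E) (X Y : E → ℝ) (H : ConvPos V X Y)
    (p : E) (hp : p ∈ V) (T : Finset E) (hT : T.Nonempty) :
    (∀ x ∈ T, x ∈ V ∧ x ≠ p) → ∃ q ∈ T, ∀ x ∈ T, 0 ≤ areaW X Y p q x := by
  classical
  induction hT using Finset.Nonempty.cons_induction with
  | singleton a =>
    intro _
    refine ⟨a, by simp, ?_⟩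
    intro x hx
    rw [Finset.mem_singleton] at hx
    subst hx
    unfold areaW
    apply le_of_eq; ring
  | cons a s ha hs ih =>
    intro h
    obtain ⟨q, hq, hq2⟩ := ih (fun x hx => h x (by simp [hx]))
    obtain ⟨haV, hap⟩ := h a (by simp)
    obtain ⟨hqV, hqp⟩ := h q (by simp [hq])
    by_cases hc : 0 ≤ areaW X Y p q a
    · refine ⟨q, by simp [hq], ?_⟩
      intro x hx
      rw [Finset.mem_cons] at hx
      rcases hx with rfl | hx
      · exact hc
      · exact hq2 x hx
    · refine ⟨a, by simp, ?_⟩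
      intro x hx
      rw [Finset.mem_cons] at hx
      rcases hx with rfl | hx
      · unfold areaW; apply le_of_eq; ring
      · by_contra hneg
        obtain ⟨hxV, hxp⟩ := h x (by simp [hx])
        have h1 := hq2 x hx
        push Not at hc hneg
        refine H p hp a haV q hqV x hxV hap hqp hxp (areaW X Y p q x) (-areaW X Y p a x)
          (-areaW X Y p q a) h1 (by linarith) (by linarith) (by linarith) ?_ ?_ <;>
        · unfold areaW; ring

theorem strict_aux {E : Type*} (V : Finset E) (X Y : E → ℝ) (H : ConvPos V X Y)
    (p q x : E) (hp : p ∈ V) (hq : q ∈ V) (hx : x ∈ V) (hqp : q ≠ p) (hxp : x ≠ p) (hxq : x ≠ q)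
    (h0 : areaW X Y p q x = 0) : False := by
  unfold areaW at h0
  have hpos : 0 < (X q - X p) ^ 2 + (Y q - Y p) ^ 2 := by
    by_contra hn
    have h1 : X q - X p = 0 := by nlinarith [sq_nonneg (X q - X p), sq_nonneg (Y q - Y p)]
    have h2 : Y q - Y p = 0 := by nlinarith [sq_nonneg (X q - X p), sq_nonneg (Y q - Y p)]
    refine H p hp q hq q hq q hq hqp hqp hqp 1 0 0 (by norm_num) le_rfl le_rfl (by norm_num) ?_ ?_
    · rw [h1]; ring
    · rw [h2]; ring
  set n := (X q - X p) ^ 2 + (Y q - Y p) ^ 2 with hn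
  set d := (X q - X p) * (X x - X p) + (Y q - Y p) * (Y x - Y p) with hd
  have e1 : n * (X x - X p) = d * (X q - X p) := by
    rw [hn, hd]; linear_combination (-(Y q - Y p)) * h0
  have e2 : n * (Y x - Y p) = d * (Y q - Y p) := by
    rw [hn, hd]; linear_combination ((X q - X p)) * h0
  clear_value n d
  rcases le_or_gt d 0 with hd0 | hd0
  · refine H p hp x hx q hq q hq hxp hqp hqp n (-d) 0 hpos.le (by linarith) le_rfl (by linarith) ?_ ?_
    · linear_combination e1
    · linear_combination e2
  rcases le_or_gt n d with hnd | hnd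
  · refine H q hq x hx p hp p hp hxq hqp.symm hqp.symm n (d - n) 0 hpos.le (by linarith) le_rfl
      (by linarith) ?_ ?_
    · linear_combination e1
    · linear_combination e2
  · refine H x hx p hp q hq q hq hxp.symm hxq.symm hxq.symm (n - d) d 0 (by linarith) hd0.le le_rfl
      (by linarith) ?_ ?_
    · linear_combination -e1
    · linear_combination -e2

theorem exists_next {E : Type*} (V : Finset E) (X Y : E → ℝ) (H : ConvPos V X Y)
    (h2 : 2 ≤ V.card) (p : E) (hp : p ∈ V) : ∃ q ∈ V, q ≠ p ∧ NextV V X Y p q := by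
  classical
  have hne : (V.erase p).Nonempty := by
    rw [← Finset.card_pos, Finset.card_erase_of_mem hp]; omega
  obtain ⟨q, hq, hq2⟩ := exists_min_aux V X Y H p hp (V.erase p) hne
    (fun x hx => ⟨Finset.mem_of_mem_erase hx, Finset.ne_of_mem_erase hx⟩)
  refine ⟨q, Finset.mem_of_mem_erase hq, Finset.ne_of_mem_erase hq, ?_⟩
  intro x hx hxp hxq
  refine lt_of_le_of_ne (hq2 x (by simp [hx, hxp])) ?_
  intro h
  exact strict_aux V X Y H p q x hp (Finset.mem_of_mem_erase hq) hx (Finset.ne_of_mem_erase hq)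
    hxp hxq h.symm

theorem exists_prev {E : Type*} (V : Finset E) (X Y : E → ℝ) (H : ConvPos V X Y)
    (h2 : 2 ≤ V.card) (p : E) (hp : p ∈ V) : ∃ r ∈ V, r ≠ p ∧ NextV V X Y r p := by
  have H' : ConvPos V Y X := by
    intro p hp x hx y hy z hz h1 h2 h3 a b c ha hb hc habc e1 e2
    exact H p hp x hx y hy z hz h1 h2 h3 a b c ha hb hc habc e2 e1
  obtain ⟨q, hq, hqp, hN⟩ := exists_next V Y X H' h2 p hp
  refine ⟨q, hq, hqp, ?_⟩
  intro x hx hxp hxq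
  have := hN x hx hxq hxp
  unfold areaW at *
  linarith

theorem card_core {E : Type*} (V : Finset E) (X Y : E → ℝ) (H : ConvPos V X Y)
    (hang : ∀ p ∈ V, ∀ q ∈ V, ∀ r ∈ V, ∀ s ∈ V, q ≠ p → r ≠ p → s ≠ q → r ≠ q → s ≠ p →
      NextV V X Y p q → NextV V X Y r p → NextV V X Y q s →
      (X p - X r) * (Y s - Y q) - (Y p - Y r) * (X s - X q) < 0) : V.card ≤ 3 := by
  classical
  by_contra hcard
  push Not at hcard
  have two : ∀ p ∈ V, ∀ q ∈ V, NextV V X Y p q → NextV V X Y q p → False := by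
    intro p hp q hq h1 h2
    obtain ⟨x, hx, hx2⟩ := Finset.exists_mem_notMem_of_card_lt_card
      (s := {p, q}) (t := V) (lt_of_le_of_lt (Finset.card_le_two) (by omega))
    simp only [Finset.mem_insert, Finset.mem_singleton, not_or] at hx2
    have a1 := h1 x hx hx2.1 hx2.2
    have a2 := h2 x hx hx2.2 hx2.1
    unfold areaW at *
    linarith
  have hV : V.Nonempty := Finset.card_pos.1 (by omega)
  obtain ⟨p1, h1⟩ := hV
  obtain ⟨p0, h0, n01, N01⟩ := exists_prev V X Y H (by omega) p1 h1
  obtain ⟨p2, h2, n12, N12⟩ := exists_next V X Y H (by omega) p1 h1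
  obtain ⟨p3, h3, n23, N23⟩ := exists_next V X Y H (by omega) p2 h2
  obtain ⟨p4, h4, n34, N34⟩ := exists_next V X Y H (by omega) p3 h3
  obtain ⟨p5, h5, n45, N45⟩ := exists_next V X Y H (by omega) p4 h4
  have n13 : p3 ≠ p1 := by rintro rfl; exact two _ h1 _ h2 N12 N23
  have n24 : p4 ≠ p2 := by rintro rfl; exact two _ h2 _ h3 N23 N34
  have n35 : p5 ≠ p3 := by rintro rfl; exact two _ h3 _ h4 N34 N45
  have n02 : p0 ≠ p2 := by rintro rfl; exact two _ h0 _ h1 N01 N12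
  have n14 : p4 ≠ p1 := by
    rintro rfl
    obtain ⟨x, hx, hx2⟩ := Finset.exists_mem_notMem_of_card_lt_card
      (s := {p4, p2, p3}) (t := V) (lt_of_le_of_lt (Finset.card_le_three) (by omega))
    simp only [Finset.mem_insert, Finset.mem_singleton, not_or] at hx2
    obtain ⟨x1, x2, x3⟩ := hx2
    have a1 := N12 x hx x1 x2
    have a2 := N23 x hx x2 x3
    have a3 := N34 x hx x3 x1
    refine H x hx p4 h1 p2 h2 p3 h3 (Ne.symm x1) (Ne.symm x2) (Ne.symm x3)
      (areaW X Y p2 p3 x) (areaW X Y p3 p4 x) (areaW X Y p4 p2 x) a2.le a3.le a1.le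
      (by linarith) ?_ ?_ <;>
    · unfold areaW; ring
  have c1 := hang p1 h1 p2 h2 p0 h0 p3 h3 n12 n01 n23 n02 n13 N12 N01 N23
  have c2 := hang p3 h3 p4 h4 p2 h2 p5 h5 n34 n23.symm n45 n24.symm n35 N34 N23 N45
  have d1 : (X p1 - X p4) * (Y p3 - Y p2) - (Y p1 - Y p4) * (X p3 - X p2) < 0 := by
    by_cases h04 : p0 = p4
    · subst h04; exact c1
    have b1 := N01 p4 h4 (Ne.symm h04) n14
    have b2 := N12 p4 h4 n14 n24
    have b3 := N12 p0 h0 n01 n02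
    have b4 := N12 p3 h3 n13 n23
    unfold areaW at *
    have m1 := mul_pos b1 b4
    have m2 := mul_pos b2 (neg_pos.2 c1)
    by_contra hc
    push Not at hc
    have m3 := mul_nonneg b3.le hc
    nlinarith
  have d2 : (X p3 - X p2) * (Y p1 - Y p4) - (Y p3 - Y p2) * (X p1 - X p4) < 0 := by
    by_cases h15 : p5 = p1
    · subst h15; exact c2
    have b1 := N45 p1 h1 n14.symm (Ne.symm h15)
    have b2 := N34 p1 h1 n13.symm n14.symm
    have b3 := N34 p5 h5 n35 n45
    have b4 := N34 p2 h2 n23.symm n24.symm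
    unfold areaW at *
    have m1 := mul_pos b1 b4
    have m2 := mul_pos b2 (neg_pos.2 c2)
    by_contra hc
    push Not at hc
    have m3 := mul_nonneg b3.le hc
    nlinarith
  linarith

theorem angle_aux {E : Type*} [NormedAddCommGroup E] [InnerProductSpace ℝ E] (a b c : E)
    (a1 a2 b1 b2 c1 c2 : ℝ) (haa : inner ℝ a a = a1 * a1 + a2 * a2)
    (hbb : inner ℝ b b = b1 * b1 + b2 * b2) (hcc : inner ℝ c c = c1 * c1 + c2 * c2)
    (hab : inner ℝ a b = a1 * b1 + a2 * b2) (hcb : inner ℝ c b = c1 * b1 + c2 * b2)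
    (hwa : 0 < b1 * a2 - b2 * a1) (hwc : 0 < b1 * c2 - b2 * c1)
    (hlt : InnerProductGeometry.angle a b + InnerProductGeometry.angle c (-b) < Real.pi) :
    0 < a1 * c2 - a2 * c1 := by
  have s1 : Real.sin (InnerProductGeometry.angle a b) * (‖a‖ * ‖b‖) = b1 * a2 - b2 * a1 := by
    rw [InnerProductGeometry.sin_angle_mul_norm_mul_norm, haa, hbb, hab,
      show (a1 * a1 + a2 * a2) * (b1 * b1 + b2 * b2) - (a1 * b1 + a2 * b2) * (a1 * b1 + a2 * b2)
        = (b1 * a2 - b2 * a1) ^ 2 by ring, Real.sqrt_sq hwa.le]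
  have s2 : Real.sin (InnerProductGeometry.angle c (-b)) * (‖c‖ * ‖b‖) = b1 * c2 - b2 * c1 := by
    rw [InnerProductGeometry.angle_neg_right, Real.sin_pi_sub,
      InnerProductGeometry.sin_angle_mul_norm_mul_norm, hcc, hbb, hcb,
      show (c1 * c1 + c2 * c2) * (b1 * b1 + b2 * b2) - (c1 * b1 + c2 * b2) * (c1 * b1 + c2 * b2)
        = (b1 * c2 - b2 * c1) ^ 2 by ring, Real.sqrt_sq hwc.le]
  have k1 : Real.cos (InnerProductGeometry.angle a b) * (‖a‖ * ‖b‖) = a1 * b1 + a2 * b2 := by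
    rw [InnerProductGeometry.cos_angle_mul_norm_mul_norm, hab]
  have k2 : Real.cos (InnerProductGeometry.angle c (-b)) * (‖c‖ * ‖b‖) = -(c1 * b1 + c2 * b2) := by
    rw [InnerProductGeometry.angle_neg_right, Real.cos_pi_sub, neg_mul,
      InnerProductGeometry.cos_angle_mul_norm_mul_norm, hcb]
  have n1 := InnerProductGeometry.angle_nonneg a b
  have n2 := InnerProductGeometry.angle_nonneg c (-b)
  have ha0 : 0 < ‖a‖ := by
    rw [norm_pos_iff]; rintro rfl
    simp only [norm_zero, zero_mul, mul_zero] at s1; linarith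
  have hb0 : 0 < ‖b‖ := by
    rw [norm_pos_iff]; rintro rfl
    simp only [norm_zero, mul_zero] at s1; linarith
  have hc0 : 0 < ‖c‖ := by
    rw [norm_pos_iff]; rintro rfl
    simp only [norm_zero, zero_mul, mul_zero] at s2; linarith
  set θ := InnerProductGeometry.angle a b
  set φ := InnerProductGeometry.angle c (-b)
  have hθ : 0 < θ := by
    rcases n1.eq_or_lt with h | h
    · rw [← h, Real.sin_zero] at s1; linarith
    · exact h
  have hs : 0 < Real.sin (θ + φ) := Real.sin_pos_of_pos_of_lt_pi (by linarith) hlt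
  rw [Real.sin_add] at hs
  have hm : 0 < (Real.sin θ * Real.cos φ + Real.cos θ * Real.sin φ) * ((‖a‖ * ‖b‖) * (‖c‖ * ‖b‖)) := by
    positivity
  have he : (Real.sin θ * Real.cos φ + Real.cos θ * Real.sin φ) * ((‖a‖ * ‖b‖) * (‖c‖ * ‖b‖))
      = (a1 * c2 - a2 * c1) * (b1 * b1 + b2 * b2) := by
    calc _ = (Real.sin θ * (‖a‖ * ‖b‖)) * (Real.cos φ * (‖c‖ * ‖b‖))
        + (Real.cos θ * (‖a‖ * ‖b‖)) * (Real.sin φ * (‖c‖ * ‖b‖)) := by ring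
      _ = _ := by rw [s1, s2, k1, k2]; ring
  rw [he] at hm
  exact pos_of_mul_pos_left hm (by nlinarith)

theorem edge_aux {E : Type*} [AddCommGroup E] [Module ℝ E] (V : Finset E) (p q : E)
    (hp : p ∈ V) (hq : q ∈ V) (hpq : p ≠ q) (f : E →ₗ[ℝ] ℝ) (c : ℝ) (hfp : f p = c) (hfq : f q = c)
    (h : ∀ x ∈ V, x ≠ p → x ≠ q → c < f x) :
    IsExtreme ℝ (convexHull ℝ (V : Set E)) (segment ℝ p q) := by
  classical
  have hge : ∀ x ∈ V, c ≤ f x := by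
    intro x hx
    by_cases h1 : x = p
    · rw [h1, hfp]
    by_cases h2 : x = q
    · rw [h2, hfq]
    exact (h x hx h1 h2).le
  have hgeA : ∀ x ∈ convexHull ℝ (V : Set E), c ≤ f x := by
    intro x hx
    have : convexHull ℝ (V : Set E) ⊆ {x | c ≤ f x} :=
      convexHull_min (fun y hy => hge y hy) (convex_halfSpace_ge f.isLinear c)
    exact this hx
  have heq : ∀ x ∈ convexHull ℝ (V : Set E), f x = c → x ∈ segment ℝ p q := by
    intro x hx hfx
    rw [Finset.mem_convexHull'] at hx
    obtain ⟨w, hw0, hw1, hwx⟩ := hx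
    have hsum : ∑ y ∈ V, w y * (f y - c) = 0 := by
      have : f x = ∑ y ∈ V, w y * f y := by
        rw [← hwx, map_sum]; simp
      simp only [mul_sub, Finset.sum_sub_distrib, ← Finset.sum_mul]
      rw [hw1, ← this, hfx]; ring
    rw [Finset.sum_eq_zero_iff_of_nonneg
      (fun y hy => mul_nonneg (hw0 y hy) (sub_nonneg.2 (hge y hy)))] at hsum
    have hz : ∀ y ∈ V, y ∉ ({p, q} : Finset E) → w y = 0 := by
      intro y hy hy2
      simp only [Finset.mem_insert, Finset.mem_singleton, not_or] at hy2
      have := h y hy hy2.1 hy2.2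
      rcases mul_eq_zero.1 (hsum y hy) with h3 | h3
      · exact h3
      · linarith
    have hsub : ({p, q} : Finset E) ⊆ V := by
      intro y hy
      simp only [Finset.mem_insert, Finset.mem_singleton] at hy
      rcases hy with rfl | rfl <;> assumption
    rw [← Finset.sum_subset hsub (fun y hy hy2 => hz y hy hy2), Finset.sum_pair hpq] at hw1
    rw [← Finset.sum_subset hsub (fun y hy hy2 => by rw [hz y hy hy2, zero_smul]),
      Finset.sum_pair hpq] at hwx
    exact ⟨w p, w q, hw0 p hp, hw0 q hq, hw1, hwx⟩
  constructor
  · exact (convex_convexHull ℝ _).segment_subset (subset_convexHull ℝ _ hp) (subset_convexHull ℝ _ hq)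
  · rintro x hx y hy z hz ⟨a, b, ha, hb, hab, hz2⟩
    obtain ⟨a', b', ha', hb', hab', hz3⟩ := hz
    have fz : f z = c := by
      rw [← hz3, map_add, map_smul, map_smul, hfp, hfq, smul_eq_mul, smul_eq_mul, ← add_mul, hab', one_mul]
    rw [← hz2, map_add, map_smul, map_smul, smul_eq_mul, smul_eq_mul] at fz
    apply heq x hx
    have h1 := hgeA x hx
    have h2 := hgeA y hy
    have h3 : c = a * c + b * c := by rw [← add_mul, hab, one_mul]
    have h4 : b * c ≤ b * f y := mul_le_mul_of_nonneg_left h2 hb.le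
    have h5 : a * f x ≤ a * c := by linarith
    exact le_antisymm (le_of_mul_le_mul_left h5 ha) h1


open EuclideanGeometry

/-- Let `A` be the convex hull of a finite set `S` in a real inner product
space, whose affine span has dimension 2 (a planar convex polygon). Assume
that for all vertices `p, q, r, s` of `A` such that `p` and `q` are adjacent,
`r` is adjacent to `p` with `r ≠ q`, and `s` is adjacent to `q` with `s ≠ p`,
one has `∠ r p q + ∠ s q p < π`. Then `A` has exactly 3 vertices, i.e. `A` is
a triangle. -/
theorem stmt_6 (E : Type*) [NormedAddCommGroup E] [InnerProductSpace ℝ E]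
    (S : Set E) (hS : S.Finite) (A : Set E) (hA : A = convexHull ℝ S)
    (hdim : Module.finrank ℝ (affineSpan ℝ A).direction = 2)
    (hangle : ∀ p q r s : E,
      p ∈ Set.extremePoints ℝ A → q ∈ Set.extremePoints ℝ A →
      r ∈ Set.extremePoints ℝ A → s ∈ Set.extremePoints ℝ A →
      (p ≠ q ∧ IsExtreme ℝ A (segment ℝ p q)) →
      (r ≠ p ∧ IsExtreme ℝ A (segment ℝ r p)) → r ≠ q →
      (s ≠ q ∧ IsExtreme ℝ A (segment ℝ s q)) → s ≠ p →
      ∠ r p q + ∠ s q p < Real.pi) :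
    (Set.extremePoints ℝ A).ncard = 3 := by
  classical
  have hVS : Set.extremePoints ℝ A ⊆ S := by rw [hA]; exact extremePoints_convexHull_subset
  have hVf : (Set.extremePoints ℝ A).Finite := hS.subset hVS
  have hAc : Convex ℝ A := by rw [hA]; exact convex_convexHull ℝ S
  have hAV : A = convexHull ℝ (Set.extremePoints ℝ A) := by
    have h1 : IsCompact A := by rw [hA]; exact hS.isCompact_convexHull ℝ
    have h2 := closure_convexHull_extremePoints h1 hAc
    rw [(hVf.isClosed_convexHull ℝ).closure_eq] at h2
    exact h2.symm
  obtain ⟨V, hV⟩ := hVf.exists_finset_coe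
  have hmem : ∀ x, x ∈ V ↔ x ∈ Set.extremePoints ℝ A := by
    intro x; rw [← hV]; simp
  have hAV' : A = convexHull ℝ (V : Set E) := by rw [hV]; exact hAV
  have hcard : (Set.extremePoints ℝ A).ncard = V.card := by rw [← hV, Set.ncard_coe_finset]
  rw [hcard]
  apply le_antisymm
  swap
  · by_contra hlt
    have hd : Module.finrank ℝ (vectorSpan ℝ (V : Set E)) = 2 := by
      rw [← direction_affineSpan, ← affineSpan_convexHull, ← hAV']; exact hdim
    rcases Nat.eq_zero_or_pos V.card with h0 | h0
    · rw [Finset.card_eq_zero] at h0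
      have hbot : vectorSpan ℝ (V : Set E) = ⊥ := by
        rw [h0, Finset.coe_empty, vectorSpan_empty]
      rw [hbot, finrank_bot] at hd
      omega
    · have := finrank_vectorSpan_image_finset_le ℝ (id : E → E) V (n := V.card - 1) (by omega)
      rw [Finset.image_id, hd] at this
      omega
  · set W := (affineSpan ℝ A).direction with hW
    have : FiniteDimensional ℝ W := Module.finite_of_finrank_pos (by omega)
    let B : OrthonormalBasis (Fin 2) ℝ W := (stdOrthonormalBasis ℝ W).reindex (finCongr hdim)
    let X : E →ₗ[ℝ] ℝ := innerₗ E (B 0 : E)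
    let Y : E →ₗ[ℝ] ℝ := innerₗ E (B 1 : E)
    have hinner : ∀ x ∈ W, ∀ y ∈ W, inner ℝ x y = X x * X y + Y x * Y y := by
      intro x hx y hy
      have := B.sum_inner_mul_inner ⟨x, hx⟩ ⟨y, hy⟩
      rw [Fin.sum_univ_two] at this
      simp only [Submodule.coe_inner] at this
      rw [← this]
      simp only [X, Y, innerₗ_apply_apply]
      rw [real_inner_comm x, real_inner_comm x]
    have hzero : ∀ x ∈ W, X x = 0 → Y x = 0 → x = 0 := by
      intro x hx h1 h2
      have := hinner x hx x hx
      rw [h1, h2] at this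
      apply inner_self_eq_zero (𝕜 := ℝ).1
      rw [this]; ring
    have hsub : ∀ x ∈ V, ∀ y ∈ V, x - y ∈ W := by
      intro x hx y hy
      have hx' := ((hmem x).1 hx).1
      have hy' := ((hmem y).1 hy).1
      exact AffineSubspace.vsub_mem_direction (subset_affineSpan ℝ A hx') (subset_affineSpan ℝ A hy')
    clear_value X Y W
    have hedge : ∀ p ∈ V, ∀ q ∈ V, p ≠ q → NextV V X Y p q → IsExtreme ℝ A (segment ℝ p q) := by
      intro p hp q hq hpq hN
      rw [hAV']
      refine edge_aux V p q hp hq hpq ((X q - X p) • Y - (Y q - Y p) • X)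
        ((X q - X p) * Y p - (Y q - Y p) * X p) ?_ ?_ ?_
      · simp
      · simp only [LinearMap.sub_apply, LinearMap.smul_apply, smul_eq_mul]; ring
      · intro x hx h1 h2
        have := hN x hx h1 h2
        unfold areaW at this
        simp only [LinearMap.sub_apply, LinearMap.smul_apply, smul_eq_mul]
        linarith
    apply card_core V X Y
    · intro p hp x hx y hy z hz hxp hyp hzp a b c ha hb hc habc e1 e2
      have hv : a • (x - p) + b • (y - p) + c • (z - p) = 0 := by
        apply hzero
        · exact W.add_mem (W.add_mem (W.smul_mem _ (hsub x hx p hp)) (W.smul_mem _ (hsub y hy p hp)))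
            (W.smul_mem _ (hsub z hz p hp))
        · simpa using e1
        · simpa using e2
      have hcv : Convex ℝ (A \ {p}) := (hAc.mem_extremePoints_iff_convex_sdiff.1 ((hmem p).1 hp)).2
      have key := hcv.sum_mem (t := Finset.univ) (w := ![a / (a + b + c), b / (a + b + c), c / (a + b + c)])
        (z := ![x, y, z]) ?_ ?_ ?_
      · apply key.2
        simp only [Fin.sum_univ_three, Matrix.cons_val_zero, Matrix.cons_val_one, Matrix.cons_val]
        rw [Set.mem_singleton_iff]
        have h3 : a • x + b • y + c • z = (a + b + c) • p := by
          rw [← sub_eq_zero, ← hv]; module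
        simp only [div_eq_inv_mul, mul_smul]
        rw [← smul_add, ← smul_add, h3, smul_smul, inv_mul_cancel₀ habc.ne', one_smul]
      · intro i _
        fin_cases i <;> simp <;> positivity
      · simp only [Fin.sum_univ_three, Matrix.cons_val_zero, Matrix.cons_val_one, Matrix.cons_val]
        field_simp
      · intro i _
        fin_cases i
        · exact ⟨((hmem x).1 hx).1, hxp⟩
        · exact ⟨((hmem y).1 hy).1, hyp⟩
        · exact ⟨((hmem z).1 hz).1, hzp⟩
    · intro p hp q hq r hr s hs hqp hrp hsq hrq hsp Npq Nrp Nqs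
      have hA1 := hangle p q r s ((hmem p).1 hp) ((hmem q).1 hq) ((hmem r).1 hr) ((hmem s).1 hs)
        ⟨hqp.symm, hedge p hp q hq hqp.symm Npq⟩ ⟨hrp, hedge r hr p hp hrp Nrp⟩ hrq
        ⟨hsq, by rw [segment_symm]; exact hedge q hq s hs hsq.symm Nqs⟩ hsp
      unfold EuclideanGeometry.angle at hA1
      simp only [vsub_eq_sub] at hA1
      rw [← neg_sub q p] at hA1
      have w1 := Npq r hr hrp hrq
      have w2 := Npq s hs hsp hsq
      unfold areaW at w1 w2
      have := angle_aux (r - p) (q - p) (s - q) (X (r - p)) (Y (r - p)) (X (q - p)) (Y (q - p))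
        (X (s - q)) (Y (s - q)) (hinner _ (hsub r hr p hp) _ (hsub r hr p hp))
        (hinner _ (hsub q hq p hp) _ (hsub q hq p hp))
        (hinner _ (hsub s hs q hq) _ (hsub s hs q hq))
        (hinner _ (hsub r hr p hp) _ (hsub q hq p hp))
        (hinner _ (hsub s hs q hq) _ (hsub q hq p hp))
        (by simp only [map_sub]; linarith) (by simp only [map_sub]; linarith) hA1
      simp only [map_sub] at this
      linarith
end

section
/- Let P = convexHull ℝ S for a finite set S ⊆ V, and suppose the affine span of P is all of V (P is a full-dimensional polytope). Assume: (i) every vertex of P lies on exactly n edges of P; (ii) any two distinct edges of P containing a common vertex are contained in a common 2-face of P; (iii) every 2-face of P has exactly 3 vertices (is a triangle). Then P has exactly n + 1 vertices; consequently these n + 1 vertices are affinely independent and P is an n-simplex, namely the convex hull of its n + 1 affinely independent vertices. -/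
/-- An edge of the polytope `P` : a convex subset of `P` that is extreme in `P`
and whose affine span has dimension 1. -/
def IsEdgeOf {V : Type*} [AddCommGroup V] [Module ℝ V] (P e : Set V) : Prop :=
  Convex ℝ e ∧ IsExtreme ℝ P e ∧ Module.finrank ℝ (affineSpan ℝ e).direction = 1

/-- A 2-face of the polytope `P` : a convex subset of `P` that is extreme in
`P` and whose affine span has dimension 2. -/
def IsTwoFaceOf {V : Type*} [AddCommGroup V] [Module ℝ V] (P F : Set V) : Prop :=
  Convex ℝ F ∧ IsExtreme ℝ P F ∧ Module.finrank ℝ (affineSpan ℝ F).direction = 2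

open Set

theorem aux_sep {V : Type*} [AddCommGroup V] [Module ℝ V] [FiniteDimensional ℝ V]
    (T : Set V) (hT : T.Finite) (s : V) (hs : s ∉ convexHull ℝ T) :
    ∃ f : V →ₗ[ℝ] ℝ, ∀ t ∈ T, f t < f s := by
  let e : V ≃ₗ[ℝ] (Fin (Module.finrank ℝ V) → ℝ) := (Module.finBasis ℝ V).equivFun
  have h1 : e s ∉ convexHull ℝ (e '' T) := by
    have := e.toLinearMap.image_convexHull T
    simp only [LinearEquiv.coe_coe] at this
    rw [← this]
    rintro ⟨x, hx, hxs⟩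
    rw [e.injective hxs] at hx
    exact hs hx
  obtain ⟨f, u, hf, hu⟩ := geometric_hahn_banach_closed_point (convex_convexHull ℝ (e '' T))
    ((hT.image e).isClosed_convexHull ℝ) h1
  refine ⟨f.toLinearMap ∘ₗ e.toLinearMap, fun t ht => ?_⟩
  exact (hf _ (subset_convexHull ℝ _ (mem_image_of_mem e ht))).trans hu

theorem aux_km {V : Type*} [AddCommGroup V] [Module ℝ V] [FiniteDimensional ℝ V]
    (T : Set V) (hT : T.Finite) :
    convexHull ℝ T = convexHull ℝ ((convexHull ℝ T).extremePoints ℝ) := by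
  let e : V ≃ₗ[ℝ] (Fin (Module.finrank ℝ V) → ℝ) := (Module.finBasis ℝ V).equivFun
  have him : ∀ A : Set V, e '' (convexHull ℝ A) = convexHull ℝ (e '' A) := fun A => by
    have := e.toLinearMap.image_convexHull A
    simpa only [LinearEquiv.coe_coe] using this
  apply e.injective.image_injective
  rw [him, him, image_extremePoints e, him]
  have hf := hT.image e
  have h := closure_convexHull_extremePoints (hf.isCompact_convexHull ℝ) (convex_convexHull ℝ _)
  have h2 := (hf.subset (extremePoints_convexHull_subset (𝕜 := ℝ) (A := e '' T))).isClosed_convexHull ℝ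
  rw [h2.closure_eq] at h
  exact h.symm

/-- A face of a convex hull is the convex hull of the generators it contains. -/
theorem aux_face {V : Type*} [AddCommGroup V] [Module ℝ V]
    (T P F : Set V) (hP : P = convexHull ℝ T) (hF : Convex ℝ F) (hext : IsExtreme ℝ P F) :
    F = convexHull ℝ (F ∩ T) := by
  have hPc : Convex ℝ P := hP ▸ convex_convexHull ℝ T
  have hTP : T ⊆ P := hP ▸ subset_convexHull ℝ T
  apply Subset.antisymm
  · intro z hz
    have hd : Convex ℝ (P \ F) := hext.convex_sdiff hPc
    have hsub : convexHull ℝ (T \ F) ⊆ P \ F :=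
      convexHull_min (fun t ht => ⟨hTP ht.1, ht.2⟩) hd
    have hzT : z ∈ convexHull ℝ (F ∩ T ∪ T \ F) := by
      have : F ∩ T ∪ T \ F = T := by rw [inter_comm]; exact inter_union_sdiff T F
      rw [this, ← hP]; exact hext.1 hz
    rcases (F ∩ T).eq_empty_or_nonempty with h1 | h1
    · rw [h1, empty_union] at hzT
      exact absurd hz (hsub hzT).2
    rcases (T \ F).eq_empty_or_nonempty with h2 | h2
    · rwa [h2, union_empty] at hzT
    rw [convexHull_union h1 h2, mem_convexJoin] at hzT
    obtain ⟨a, ha, b, hb, hab⟩ := hzT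
    have hbF := hsub hb
    have haF : a ∈ F := convexHull_min inter_subset_left hF ha
    rcases eq_or_ne a z with rfl | haz
    · exact ha
    rcases eq_or_ne b z with rfl | hbz
    · exact absurd hz hbF.2
    have := mem_openSegment_of_ne_left_right haz hbz hab
    exact absurd (hext.right_mem_of_mem_openSegment (hext.1 haF) hbF.1 hz this) hbF.2
  · exact convexHull_min inter_subset_left hF

theorem aux_edge {V : Type*} [AddCommGroup V] [Module ℝ V] [FiniteDimensional ℝ V]
    (P : Set V) (hP : P = convexHull ℝ (P.extremePoints ℝ)) (e : Set V) (he : IsEdgeOf P e)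
    (x : V) (hx : x ∈ P.extremePoints ℝ) (hxe : x ∈ e) :
    ∃ y ∈ P.extremePoints ℝ, y ≠ x ∧ e = segment ℝ x y := by
  obtain ⟨hc, hext, hdim⟩ := he
  have hface := aux_face _ P e hP hc hext
  have hcol : Collinear ℝ e := by
    rw [collinear_iff_finrank_le_one, ← direction_affineSpan, hdim]
  have hy : ∃ y ∈ e ∩ P.extremePoints ℝ, y ≠ x := by
    by_contra! h
    have : e ∩ P.extremePoints ℝ = {x} := by
      ext y; constructor
      · exact fun hy => h y hy
      · rintro rfl; exact ⟨hxe, hx⟩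
    rw [this, convexHull_singleton] at hface
    rw [hface, direction_affineSpan, vectorSpan_singleton, finrank_bot] at hdim
    exact zero_ne_one hdim
  obtain ⟨y, ⟨hye, hy⟩, hyx⟩ := hy
  refine ⟨y, hy, hyx, ?_⟩
  have : e ∩ P.extremePoints ℝ = {x, y} := by
    ext z; constructor
    · rintro ⟨hze, hz⟩
      have hcol3 : Collinear ℝ ({x, y, z} : Set V) := hcol.subset (by
        rintro w (rfl | rfl | rfl) <;> assumption)
      rw [mem_insert_iff, mem_singleton_iff]
      have key : ∀ a b c : V, a ∈ P → c ∈ P → b ∈ P.extremePoints ℝ → Wbtw ℝ a b c →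
          a = b ∨ c = b := by
        intro a b c ha hc hb hw
        exact (mem_extremePoints_iff_forall_segment.1 hb).2 a ha c hc (mem_segment_iff_wbtw.2 hw)
      rcases hcol3.wbtw_or_wbtw_or_wbtw with h | h | h
      · rcases key _ _ _ hx.1 hz.1 hy h with h | h
        · exact absurd h.symm hyx
        · exact Or.inr h
      · rcases key _ _ _ hy.1 hx.1 hz h with h | h
        · exact Or.inr h.symm
        · exact Or.inl h.symm
      · rcases key _ _ _ hz.1 hy.1 hx h with h | h
        · exact Or.inl h
        · exact absurd h hyx
    · rintro (rfl | rfl)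
      exacts [⟨hxe, hx⟩, ⟨hye, hy⟩]
  rw [this, convexHull_pair] at hface
  exact hface

theorem aux_dim_segment {V : Type*} [AddCommGroup V] [Module ℝ V] (x y : V) (h : y ≠ x) :
    Module.finrank ℝ (affineSpan ℝ (segment ℝ x y)).direction = 1 := by
  rw [← convexHull_pair, affineSpan_convexHull, direction_affineSpan, vectorSpan_pair]
  exact finrank_span_singleton (by simpa [sub_eq_zero] using h.symm)

theorem aux_seg_mem {V : Type*} [AddCommGroup V] [Module ℝ V] (P : Set V) (x y z : V)
    (hx : x ∈ P) (hy : y ∈ P) (hz : z ∈ P.extremePoints ℝ) (h : z ∈ segment ℝ x y) (hzx : z ≠ x) :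
    z = y := by
  rcases (mem_extremePoints_iff_forall_segment.1 hz).2 x hx y hy h with h | h
  · exact absurd h.symm hzx
  · exact h.symm

/-- In a triangular face every pair of vertices spans an edge. -/
theorem aux_tri {V : Type*} [AddCommGroup V] [Module ℝ V] [FiniteDimensional ℝ V]
    (P : Set V) (hP : P = convexHull ℝ (P.extremePoints ℝ)) (F : Set V) (hF : IsTwoFaceOf P F)
    (h3 : (F.extremePoints ℝ).ncard = 3) (x y z : V)
    (hx : x ∈ P.extremePoints ℝ) (hy : y ∈ P.extremePoints ℝ) (hz : z ∈ P.extremePoints ℝ)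
    (hxF : x ∈ F) (hyF : y ∈ F) (hzF : z ∈ F) (hxy : x ≠ y) (hxz : x ≠ z) (hyz : y ≠ z) :
    IsEdgeOf P (segment ℝ y z) := by
  obtain ⟨hc, hext, hdim⟩ := hF
  have hface := aux_face _ P F hP hc hext
  rw [hext.extremePoints_eq] at h3
  have hset : ({x, y, z} : Set V) = F ∩ P.extremePoints ℝ := by
    apply eq_of_subset_of_ncard_le
    · rintro w (rfl | rfl | rfl) <;> exact ⟨by assumption, by assumption⟩
    · rw [h3, ncard_eq_three.2 ⟨x, y, z, hxy, hxz, hyz, rfl⟩]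
    · exact finite_of_ncard_ne_zero (by omega)
  rw [← hset] at hface
  have hncol : ¬ Collinear ℝ ({x, y, z} : Set V) := by
    rw [collinear_iff_finrank_le_one]
    rw [hface, affineSpan_convexHull, direction_affineSpan] at hdim
    omega
  have hnot : x - y ∉ Submodule.span ℝ {z - y} := by
    intro hmem
    obtain ⟨r, hr⟩ := Submodule.mem_span_singleton.1 hmem
    apply hncol
    rw [collinear_iff_of_mem (p₀ := y) (by simp)]
    refine ⟨z - y, ?_⟩
    rintro p (rfl | rfl | rfl)
    · exact ⟨r, by rw [hr]; simp⟩
    · exact ⟨0, by simp⟩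
    · exact ⟨1, by simp⟩
  obtain ⟨g0, hg0, hker⟩ := Submodule.exists_le_ker_of_notMem hnot
  have hg0z : g0 (z - y) = 0 := hker (Submodule.mem_span_singleton_self _)
  obtain ⟨g, hg, hgz⟩ : ∃ g : V →ₗ[ℝ] ℝ, g y < g x ∧ g z = g y := by
    rw [map_sub] at hg0 hg0z
    rcases lt_or_gt_of_ne hg0 with h | h
    · exact ⟨-g0, by simp; linarith, by simp; linarith⟩
    · exact ⟨g0, by linarith, by linarith⟩
  have hge : ∀ p ∈ F, g y ≤ g p := by
    intro p hp
    rw [hface] at hp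
    have : convexHull ℝ {x, y, z} ⊆ {p | g y ≤ g p} := by
      apply convexHull_min
      · rintro w (rfl | rfl | rfl)
        · exact hg.le
        · exact (le_refl (g w) : g w ≤ g w)
        · exact hgz.ge
      · exact convex_halfSpace_ge g.isLinear _
    exact this hp
  have hGc : Convex ℝ {p | p ∈ F ∧ g p ≤ g y} := hc.inter (convex_halfSpace_le g.isLinear _)
  have hGe : IsExtreme ℝ F {p | p ∈ F ∧ g p ≤ g y} := by
    refine ⟨fun p hp => hp.1, ?_⟩
    rintro a ha b hb c ⟨hcF, hcg⟩ ⟨α, β, hα, hβ, hαβ, rfl⟩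
    refine ⟨ha, ?_⟩
    simp only [map_add, map_smul, smul_eq_mul] at hcg
    have h1 := hge a ha
    have h2 := hge b hb
    by_contra! hlt
    have : g y = α * g y + β * g y := by rw [← add_mul, hαβ, one_mul]
    nlinarith [mul_lt_mul_of_pos_left hlt hα, mul_le_mul_of_nonneg_left h2 hβ.le]
  have hG := aux_face _ F _ hface hGc hGe
  have hGs : {p | p ∈ F ∧ g p ≤ g y} ∩ {x, y, z} = {y, z} := by
    ext p; constructor
    · rintro ⟨⟨-, hp⟩, rfl | rfl | rfl⟩
      · exact absurd hp (not_le.2 hg)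
      · simp
      · simp
    · rintro (rfl | rfl)
      · exact ⟨⟨hyF, le_refl _⟩, by simp⟩
      · exact ⟨⟨hzF, hgz.le⟩, by simp⟩
  rw [hGs, convexHull_pair] at hG
  rw [hG] at hGe
  exact ⟨convex_segment _ _, hext.trans hGe, aux_dim_segment _ _ hyz.symm⟩

/-- A vertex that does not maximise `f` has a neighbour with larger value of `f`. -/
theorem aux_improve {V : Type*} [AddCommGroup V] [Module ℝ V] [FiniteDimensional ℝ V]
    (P : Set V) (hE : (P.extremePoints ℝ).Finite) (hP : P = convexHull ℝ (P.extremePoints ℝ))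
    (w : V) (hw : w ∈ P.extremePoints ℝ) (f : V →ₗ[ℝ] ℝ)
    (v : V) (hv : v ∈ P.extremePoints ℝ) (hfv : f w < f v) :
    ∃ y ∈ P.extremePoints ℝ, y ≠ w ∧ IsEdgeOf P (segment ℝ w y) ∧ f w < f y := by
  have hPc : Convex ℝ P := hP ▸ convex_convexHull ℝ _
  have hw0 : w ∉ convexHull ℝ (P.extremePoints ℝ \ {w}) := by
    have := (hPc.mem_extremePoints_iff_mem_sdiff_convexHull_sdiff.1 hw).2
    exact fun h => this (convexHull_mono (sdiff_subset_sdiff_left extremePoints_subset) h)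
  obtain ⟨h0, hh0⟩ := aux_sep _ (hE.subset sdiff_subset) w hw0
  obtain ⟨h, hh⟩ : ∃ h : V →ₗ[ℝ] ℝ, ∀ s ∈ P.extremePoints ℝ, s ≠ w → 0 < h (s - w) :=
    ⟨-h0, fun s hs hsw => by have := hh0 s ⟨hs, hsw⟩; simpa using this⟩
  set T : Set V := (fun s => (h (s - w))⁻¹ • (s - w)) '' (P.extremePoints ℝ \ {w}) with hTdef
  have hTf : T.Finite := (hE.subset sdiff_subset).image _
  set Q := convexHull ℝ T with hQ
  have hQc : Convex ℝ Q := convex_convexHull ℝ T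
  have hvw : v ≠ w := by rintro rfl; exact lt_irrefl _ hfv
  have hTQ : T ⊆ Q := subset_convexHull ℝ T
  obtain ⟨q, hq, hfq⟩ : ∃ q ∈ Q.extremePoints ℝ, 0 < f q := by
    by_contra! hcon
    have hsub : Q ⊆ {p | f p ≤ 0} := by
      rw [hQ, aux_km T hTf]
      exact convexHull_min hcon (convex_halfSpace_le f.isLinear _)
    have h1 := hsub (hTQ ⟨v, ⟨hv, hvw⟩, rfl⟩)
    have h2 := hh v hv hvw
    simp only [mem_ofPred_eq, map_smul, smul_eq_mul] at h1
    have h3 : 0 < f (v - w) := by rw [map_sub]; linarith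
    have := mul_pos (inv_pos.2 h2) h3
    linarith
  obtain ⟨s, ⟨hs, hsw⟩, hsq⟩ := extremePoints_convexHull_subset hq
  have hsw : s ≠ w := hsw
  have hspos := hh s hs hsw
  have hsq' : s - w = h (s - w) • q := by
    rw [← hsq]; simp only; rw [smul_smul, mul_inv_cancel₀ hspos.ne', one_smul]
  have hfs : f w < f s := by
    have : f (s - w) = h (s - w) * f q := by
      conv_lhs => rw [hsq']
      simp
    have h2 := mul_pos hspos hfq
    rw [map_sub] at this; linarith
  -- every point of `P` lies in the cone over `Q`
  have hcone : ∀ a ∈ P, 0 ≤ h (a - w) ∧ ∃ r ∈ Q, a - w = h (a - w) • r := by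
    have hconv : Convex ℝ {a | 0 ≤ h (a - w) ∧ ∃ r ∈ Q, a - w = h (a - w) • r} := by
      rintro a ⟨ha, ra, hra, hae⟩ b ⟨hb, rb, hrb, hbe⟩ α β hα hβ hαβ
      have hsplit : α • a + β • b - w = α • (a - w) + β • (b - w) := by
        have : w = α • w + β • w := by rw [← add_smul, hαβ, one_smul]
        rw [smul_sub, smul_sub]; nth_rewrite 1 [this]; abel
      have hval : h (α • a + β • b - w) = α * h (a - w) + β * h (b - w) := by
        rw [hsplit]; simp
      obtain ⟨r, hr, hre⟩ := hQc.exists_mem_add_smul_eq hra hrb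
        (mul_nonneg hα ha) (mul_nonneg hβ hb)
      refine ⟨by rw [hval]; positivity, r, hr, ?_⟩
      rw [hval, hre, hsplit, mul_smul, mul_smul, ← hae, ← hbe]
    have hsub : P ⊆ {a | 0 ≤ h (a - w) ∧ ∃ r ∈ Q, a - w = h (a - w) • r} := by
      rw [hP]
      refine convexHull_min (fun t ht => ?_) hconv
      rcases eq_or_ne t w with rfl | htw
      · exact ⟨by simp, q, hq.1, by simp⟩
      · have hp := hh t ht htw
        refine ⟨hp.le, _, hTQ ⟨t, ⟨ht, htw⟩, rfl⟩, ?_⟩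
        simp only
        rw [smul_smul, mul_inv_cancel₀ hp.ne', one_smul]
    exact hsub
  set e : Set V := {p | p ∈ P ∧ p - w = h (p - w) • q} with he
  have hec : Convex ℝ e := by
    rintro a ⟨ha, hae⟩ b ⟨hb, hbe⟩ α β hα hβ hαβ
    refine ⟨hPc ha hb hα hβ hαβ, ?_⟩
    have hsplit : α • a + β • b - w = α • (a - w) + β • (b - w) := by
      have : w = α • w + β • w := by rw [← add_smul, hαβ, one_smul]
      rw [smul_sub, smul_sub]; nth_rewrite 1 [this]; abel
    rw [hsplit, map_add, map_smul, map_smul, add_smul, smul_assoc, smul_assoc, ← hae, ← hbe]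
  have hee : IsExtreme ℝ P e := by
    refine ⟨fun p hp => hp.1, ?_⟩
    rintro a ha b hb c ⟨hcP, hce⟩ ⟨α, β, hα, hβ, hαβ, rfl⟩
    refine ⟨ha, ?_⟩
    have hsplit : α • a + β • b - w = α • (a - w) + β • (b - w) := by
      have : w = α • w + β • w := by rw [← add_smul, hαβ, one_smul]
      rw [smul_sub, smul_sub]; nth_rewrite 1 [this]; abel
    have hval : h (α • a + β • b - w) = α * h (a - w) + β * h (b - w) := by
      rw [hsplit]; simp
    obtain ⟨ha0, ra, hra, hae⟩ := hcone a ha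
    obtain ⟨hb0, rb, hrb, hbe⟩ := hcone b hb
    rw [hval, hsplit] at hce
    generalize h (a - w) = A at *
    generalize h (b - w) = B at *
    rw [hae, hbe, smul_smul, smul_smul] at hce
    rw [hae]
    rcases ha0.eq_or_lt with rfl | hA
    · simp
    congr 1
    have hαA := mul_pos hα hA
    rcases hb0.eq_or_lt with rfl | hB
    · simp only [mul_zero, zero_smul, add_zero] at hce
      exact smul_right_injective V hαA.ne' hce
    · have hβB := mul_pos hβ hB
      have hsum : 0 < α * A + β * B := by positivity
      refine hq.2 hra hrb ⟨(α * A) / (α * A + β * B), (β * B) / (α * A + β * B),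
        by positivity, by positivity, by field_simp, ?_⟩
      have := congrArg (fun u => (α * A + β * B)⁻¹ • u) hce
      simp only [smul_add, smul_smul, inv_mul_cancel₀ hsum.ne', one_smul] at this
      rw [← this, div_eq_inv_mul, div_eq_inv_mul]
  have hwe : w ∈ e := ⟨hw.1, by simp⟩
  have hse : s ∈ e := ⟨hs.1, hsq'⟩
  have hedge : IsEdgeOf P e := by
    refine ⟨hec, hee, ?_⟩
    rw [direction_affineSpan]
    apply le_antisymm
    · rw [← collinear_iff_finrank_le_one, collinear_iff_of_mem hwe]
      refine ⟨q, fun p hp => ⟨h (p - w), ?_⟩⟩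
      rw [← hp.2]; simp
    · rw [← direction_affineSpan, ← aux_dim_segment w s hsw, direction_affineSpan,
        direction_affineSpan]
      exact Submodule.finrank_mono (vectorSpan_mono ℝ (hec.segment_subset hwe hse))
  obtain ⟨y, hy, hyw, hey⟩ := aux_edge P hP e hedge w hw hwe
  refine ⟨y, hy, hyw, hey ▸ hedge, ?_⟩
  rw [hey] at hse
  rw [← aux_seg_mem P w y s hw.1 hy.1 hs hse hsw]
  exact hfs

/-- Let `n ≥ 2`, let `V` be an `n`-dimensional real vector space and let
`P = convexHull ℝ S` be a full-dimensional polytope in `V`. Assume: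
(i) every vertex of `P` lies on exactly `n` edges of `P`;
(ii) any two distinct edges of `P` containing a common vertex are contained in
a common 2-face of `P`;
(iii) every 2-face of `P` has exactly 3 vertices (is a triangle).
Then `P` has exactly `n + 1` vertices; consequently these `n + 1` vertices are
affinely independent and `P` is an `n`-simplex, namely the convex hull of its
`n + 1` affinely independent vertices. -/
theorem stmt_7 (n : ℕ) (hn : 2 ≤ n)
    (V : Type*) [AddCommGroup V] [Module ℝ V]
    (hdimV : Module.finrank ℝ V = n)
    (S : Set V) (hS : S.Finite)
    (P : Set V) (hP : P = convexHull ℝ S)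
    (hfull : affineSpan ℝ P = ⊤)
    (hi : ∀ x ∈ Set.extremePoints ℝ P,
      {e : Set V | IsEdgeOf P e ∧ x ∈ e}.ncard = n)
    (hii : ∀ e₁ e₂ : Set V, ∀ x ∈ Set.extremePoints ℝ P,
      IsEdgeOf P e₁ → IsEdgeOf P e₂ → x ∈ e₁ → x ∈ e₂ → e₁ ≠ e₂ →
      ∃ F : Set V, IsTwoFaceOf P F ∧ e₁ ⊆ F ∧ e₂ ⊆ F)
    (hiii : ∀ F : Set V, IsTwoFaceOf P F →
      (Set.extremePoints ℝ F).ncard = 3) :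
    (Set.extremePoints ℝ P).ncard = n + 1 ∧
      ∃ ps : Fin (n + 1) → V, AffineIndependent ℝ ps ∧
        Set.range ps = Set.extremePoints ℝ P ∧
        P = convexHull ℝ (Set.range ps) := by
  have : FiniteDimensional ℝ V := Module.finite_of_finrank_pos (by omega)
  have hE : (P.extremePoints ℝ).Finite := hS.subset (hP ▸ extremePoints_convexHull_subset)
  have hPE : P = convexHull ℝ (P.extremePoints ℝ) := by
    rw [hP]; exact aux_km S hS
  -- neighbours of a vertex
  let N : V → Set V := fun x => {y | y ∈ P.extremePoints ℝ ∧ y ≠ x ∧ IsEdgeOf P (segment ℝ x y)}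
  have hinj : ∀ x ∈ P.extremePoints ℝ, InjOn (fun y => segment ℝ x y) (N x) := by
    intro x hx y hy z hz hyz
    simp only at hyz
    exact aux_seg_mem P x z y hx.1 hz.1.1 hy.1 (hyz ▸ right_mem_segment ℝ x y) hy.2.1
  have hcard : ∀ x ∈ P.extremePoints ℝ, (N x).ncard = n := by
    intro x hx
    rw [← hi x hx, ← ncard_image_of_injOn (hinj x hx)]
    congr 1
    ext e; constructor
    · rintro ⟨y, hy, rfl⟩
      exact ⟨hy.2.2, left_mem_segment ℝ x y⟩
    · rintro ⟨he, hxe⟩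
      obtain ⟨y, hy, hyx, rfl⟩ := aux_edge P hPE e he x hx hxe
      exact ⟨y, ⟨hy, hyx, he⟩, rfl⟩
  have hNE : ∀ x, N x ⊆ P.extremePoints ℝ := fun x y hy => hy.1
  have hNfin : ∀ x, (N x).Finite := fun x => hE.subset (hNE x)
  have htri : ∀ x ∈ P.extremePoints ℝ, ∀ y ∈ N x, ∀ z ∈ N x, z ≠ y → z ∈ N y := by
    intro x hx y hy z hz hzy
    obtain ⟨F, hF, h1, h2⟩ := hii _ _ x hx hy.2.2 hz.2.2 (left_mem_segment ℝ x y)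
      (left_mem_segment ℝ x z) (fun h => hzy (hinj x hx hy hz h).symm)
    exact ⟨hz.1, hzy, aux_tri P hPE F hF (hiii F hF) x y z hx hy.1 hz.1
      (h1 (left_mem_segment ℝ x y)) (h1 (right_mem_segment ℝ x y)) (h2 (right_mem_segment ℝ x z))
      hy.2.1.symm hz.2.1.symm hzy.symm⟩
  obtain ⟨x, hx⟩ : (P.extremePoints ℝ).Nonempty := by
    rw [nonempty_iff_ne_empty]
    intro h
    rw [h, convexHull_empty] at hPE
    rw [hPE, AffineSubspace.span_empty] at hfull
    exact AffineSubspace.bot_ne_top ℝ V V hfull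
  let C := insert x (N x)
  have hxN : x ∉ N x := fun h => h.2.1 rfl
  have hCcard : C.ncard = n + 1 := by
    rw [ncard_insert_of_notMem hxN (hNfin x), hcard x hx]
  have hCfin : C.Finite := (hNfin x).insert x
  have hCE : C ⊆ P.extremePoints ℝ := insert_subset hx (hNE x)
  have hCN : ∀ w ∈ C, C \ {w} = N w := by
    intro w hw
    apply eq_of_subset_of_ncard_le _ _ (hNfin w)
    · rintro z ⟨hz, hzw⟩
      have hzw : z ≠ w := hzw
      rcases hw with rfl | hw
      · rcases hz with rfl | hz
        · exact absurd rfl hzw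
        · exact hz
      · rcases hz with rfl | hz
        · exact ⟨hx, hzw, by rw [segment_symm]; exact hw.2.2⟩
        · exact htri x hx w hw z hz hzw
    · rw [hcard w (hCE hw), ncard_sdiff_singleton_of_mem hw, hCcard]; simp
  have hEC : P.extremePoints ℝ = C := by
    refine Subset.antisymm (fun v hv => ?_) hCE
    by_contra hvC
    have hPc : Convex ℝ P := hP ▸ convex_convexHull ℝ _
    have hv0 : v ∉ convexHull ℝ (P.extremePoints ℝ \ {v}) := by
      have := (hPc.mem_extremePoints_iff_mem_sdiff_convexHull_sdiff.1 hv).2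
      exact fun h => this (convexHull_mono (sdiff_subset_sdiff_left extremePoints_subset) h)
    obtain ⟨f, hf⟩ := aux_sep _ (hE.subset sdiff_subset) v hv0
    obtain ⟨w, hw, hmax⟩ := hCfin.exists_maximalFor f C ⟨x, mem_insert _ _⟩
    have hwv : w ≠ v := by rintro rfl; exact hvC hw
    obtain ⟨y, hy, hyw, hye, hfy⟩ := aux_improve P hE hPE w (hCE hw) f v hv (hf w ⟨hCE hw, hwv⟩)
    have hyC : y ∈ C \ {w} := by rw [hCN w hw]; exact ⟨hy, hyw, hye⟩
    exact absurd (hmax hyC.1 hfy.le) (not_le.2 hfy)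
  have hEcard : (P.extremePoints ℝ).ncard = n + 1 := by rw [hEC, hCcard]
  refine ⟨hEcard, ?_⟩
  have : Fintype (P.extremePoints ℝ) := hE.fintype
  have hft : Fintype.card (P.extremePoints ℝ) = n + 1 := by
    rw [← Nat.card_eq_fintype_card]; exact hEcard
  let φ := (Fintype.equivFinOfCardEq hft).symm
  have hrange : range (fun i => (φ i : V)) = P.extremePoints ℝ := by
    ext v; constructor
    · rintro ⟨i, rfl⟩; exact (φ i).2
    · intro hv; exact ⟨φ.symm ⟨v, hv⟩, by simp⟩
  refine ⟨fun i => (φ i : V), ?_, hrange, by rw [hrange]; exact hPE⟩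
  rw [affineIndependent_iff_finrank_vectorSpan_eq ℝ _ (Fintype.card_fin (n + 1)), hrange,
    ← direction_affineSpan, ← affineSpan_convexHull, ← hPE, hfull, AffineSubspace.direction_top,
    finrank_top, hdimV]
end
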